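/- arXiv:0711.1155 — 3 statements merged into one kernel-verified Lean document; each statement's English description precedes it below -/
import Mathlib

section
/- Let V be a complex vector space of dimension n > 1 with a Hermitian inner product g whose associated real (1,1)-form is η. Let α and β be real skew-symmetric forms of type (1,1) on V. If α is nonnegative (i.e., the associated Hermitian form is positive semidefinite) and β is nonnegative, and α ∧ β ∧ η^{n-2} = 0, then α ∧ β = 0. -/
set_option synthInstance.maxHeartbeats 1000000
open scoped ComplexOrder
set_option maxHeartbeats 1000000

set_option maxHeartbeats 1000000

open scoped BigOperators
noncomputable section

/-- The model `n`-dimensional complex vector space with its Hermitian inner product `g`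
(unitary coordinates). -/
abbrev Em (n : ℕ) := EuclideanSpace ℂ (Fin n)

/-- The complexified dual: real-linear functionals with values in `ℂ`. -/
abbrev Wc (n : ℕ) := Em n →ₗ[ℝ] ℂ

/-- The exterior algebra of the complexified dual, where wedge products of forms live. -/
abbrev ExtAlg (n : ℕ) := ExteriorAlgebra ℂ (Wc n)

/-- The coordinate `(1,0)`-covector `ζ_j`. -/
noncomputable def zeta (n : ℕ) (j : Fin n) : Wc n :=
  ((EuclideanSpace.proj j : Em n →L[ℂ] ℂ).toLinearMap).restrictScalars ℝ

/-- The conjugate coordinate `(0,1)`-covector `ζ̄_j`. -/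
noncomputable def zetaBar (n : ℕ) (j : Fin n) : Wc n :=
  Complex.conjLIE.toLinearEquiv.toLinearMap ∘ₗ zeta n j

/-- The fundamental `(1,1)`-form `η = i Σ ζ_j ∧ ζ̄_j` of the Hermitian inner product. -/
noncomputable def eta (n : ℕ) : ExtAlg n :=
  Complex.I • ∑ j, ExteriorAlgebra.ι ℂ (zeta n j) * ExteriorAlgebra.ι ℂ (zetaBar n j)

/-- The real skew-symmetric `(1,1)`-form `i Σ A_{ij} ζ_i ∧ ζ̄_j` associated to a Hermitian
matrix `A` (in unitary coordinates). -/
noncomputable def form11 (n : ℕ) (A : Matrix (Fin n) (Fin n) ℂ) : ExtAlg n :=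
  Complex.I • ∑ i, ∑ j, A i j • (ExteriorAlgebra.ι ℂ (zeta n i) * ExteriorAlgebra.ι ℂ (zetaBar n j))

/-- The `(1,0)`-form `Σ a_j ζ_j` with coefficients `a`. -/
noncomputable def form10 (n : ℕ) (a : Fin n → ℂ) : ExtAlg n :=
  ∑ j, a j • ExteriorAlgebra.ι ℂ (zeta n j)

/-- The conjugate `(0,1)`-form `Σ ā_j ζ̄_j`. -/
noncomputable def form01 (n : ℕ) (a : Fin n → ℂ) : ExtAlg n :=
  ∑ j, (starRingEnd ℂ (a j)) • ExteriorAlgebra.ι ℂ (zetaBar n j)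

/-- The Hermitian form of the matrix `B` evaluated at `x`. -/
noncomputable def quadForm (n : ℕ) (B : Matrix (Fin n) (Fin n) ℂ) (x : Fin n → ℂ) : ℂ :=
  ∑ i, ∑ j, (starRingEnd ℂ) (x i) * B i j * x j

/-- The real covector `u_j = Re ζ_j` (valued in `ℂ` via the canonical embedding). -/
noncomputable def uu (n : ℕ) (j : Fin n) : Wc n :=
  (Complex.ofRealCLM.toLinearMap ∘ₗ Complex.reCLM.toLinearMap) ∘ₗ zeta n j

/-- The real covector `v_j = Im ζ_j` (valued in `ℂ` via the canonical embedding). -/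
noncomputable def vv (n : ℕ) (j : Fin n) : Wc n :=
  (Complex.ofRealCLM.toLinearMap ∘ₗ Complex.imCLM.toLinearMap) ∘ₗ zeta n j

/-- The real volume element `u_1 ∧ v_1 ∧ ⋯ ∧ u_n ∧ v_n`. -/
noncomputable def volForm (n : ℕ) : ExtAlg n :=
  (List.ofFn fun j : Fin n => ExteriorAlgebra.ι ℂ (uu n j) * ExteriorAlgebra.ι ℂ (vv n j)).prod

section CommutativeAlgebra

open Finset

variable {R : Type*} [CommRing R] {ι : Type*}

theorem sum_pow_card_of_sq_eq_zero [DecidableEq ι] (c : ι → R) (hc : ∀ i, c i * c i = 0)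
    (S : Finset ι) :
    (∑ s ∈ S, c s) ^ #S = ((#S).factorial : R) * ∏ s ∈ S, c s ∧
      (∑ s ∈ S, c s) ^ (#S + 1) = 0 := by
  have top : ∀ S : Finset ι, (∑ s ∈ S, c s) * ∏ s ∈ S, c s = 0 := by
    intro S
    rw [sum_mul]
    refine sum_eq_zero fun s hs => ?_
    rw [← mul_prod_erase S c hs, ← mul_assoc, hc, zero_mul]
  have key : ∀ (x t : R), x * x = 0 → ∀ m : ℕ,
      (x + t) ^ (m + 1) = t ^ (m + 1) + (m + 1) * (x * t ^ m) := by
    intro x t hx m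
    induction m with
    | zero => simp [add_comm]
    | succ m ih =>
      rw [pow_succ, ih]
      push_cast
      linear_combination ((m : R) + 1) * t ^ m * hx
  have main : (∑ s ∈ S, c s) ^ #S = ((#S).factorial : R) * ∏ s ∈ S, c s := by
    induction S using Finset.induction_on with
    | empty => simp
    | insert a S ha ih =>
      have hz : (∑ s ∈ S, c s) ^ (#S + 1) = 0 := by
        rw [pow_succ, ih, mul_assoc, mul_comm (∏ s ∈ S, c s), top, mul_zero]
      rw [sum_insert ha, card_insert_of_notMem ha, key _ _ (hc a), hz, ih, prod_insert ha,
        Nat.factorial_succ]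
      push_cast
      ring
  refine ⟨main, ?_⟩
  rw [pow_succ, main, mul_assoc, mul_comm (∏ s ∈ S, c s), top, mul_zero]

theorem mul_sum_pow_eq_mul_sum_compl_pow [Fintype ι] [DecidableEq ι] (c : ι → R) (x : R)
    (T : Finset ι) (hx : ∀ t ∈ T, x * c t = 0) (m : ℕ) :
    x * (∑ s, c s) ^ m = x * (∑ s ∈ Tᶜ, c s) ^ m := by
  have hT : x * ∑ s ∈ T, c s = 0 := by
    rw [mul_sum]
    exact sum_eq_zero hx
  induction m with
  | zero => simp
  | succ m ih =>
    rw [pow_succ, ← mul_assoc, ih, pow_succ, ← sum_add_sum_compl T c]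
    linear_combination (∑ s ∈ Tᶜ, c s) ^ m * hT

/-- The top-degree product `E i j * E k l * (∑ s, E s s) ^ (n - 2)` for elements which multiply
like the `(1,1)`-forms `ζ_i ∧ ζ̄_j`. -/
theorem mul_mul_sum_diag_pow {n : ℕ} (hn : 1 < n) (E : Fin n → Fin n → R)
    (hrow : ∀ i j l, E i j * E i l = 0) (hcol : ∀ i k j, E i j * E k j = 0)
    (hswap : ∀ i j k l, E i j * E k l = -(E i l * E k j)) (i j k l : Fin n) :
    E i j * E k l * (∑ s, E s s) ^ (n - 2) =
      ((if i = j ∧ k = l then 1 else 0) - (if i = l ∧ k = j then 1 else 0)) *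
        (((n - 2).factorial : R) * ∏ s, E s s) := by
  have diag : ∀ i k : Fin n, i ≠ k → E i i * E k k * (∑ s, E s s) ^ (n - 2) =
      ((n - 2).factorial : R) * ∏ s, E s s := by
    intro i k hik
    have hcard : #({i, k} : Finset (Fin n))ᶜ = n - 2 := by
      rw [card_compl, card_pair hik, Fintype.card_fin]
    rw [mul_sum_pow_eq_mul_sum_compl_pow (fun s => E s s) _ {i, k}]
    · have := (sum_pow_card_of_sq_eq_zero (fun s => E s s) (fun s => hrow s s s) {i, k}ᶜ).1
      rw [hcard] at this
      rw [this, ← prod_mul_prod_compl {i, k} fun s => E s s, prod_pair hik]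
      ring
    · intro t ht
      rw [mem_insert, mem_singleton] at ht
      rcases ht with rfl | rfl
      · rw [mul_right_comm, hrow, zero_mul]
      · rw [mul_assoc, hrow, mul_zero]
  by_cases hik : i = k
  · subst hik
    rw [hrow, zero_mul]
    simp [and_comm]
  by_cases hjl : j = l
  · subst hjl
    rw [hcol, zero_mul]
    simp
  by_cases h1 : i = j ∧ k = l
  · obtain ⟨rfl, rfl⟩ := h1
    rw [diag i k hik]
    simp [hik]
  by_cases h2 : i = l ∧ k = j
  · obtain ⟨rfl, rfl⟩ := h2
    rw [hswap, neg_mul, diag i k hik]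
    simp [hik]
  rw [if_neg h1, if_neg h2, sub_self, zero_mul,
    mul_sum_pow_eq_mul_sum_compl_pow (fun s => E s s) _ {i, j, k, l}]
  · have hT : 3 ≤ #({i, j, k, l} : Finset (Fin n)) := by
      by_cases hij : i = j
      · have hkl : k ≠ l := fun h => h1 ⟨hij, h⟩
        have : #({i, k, l} : Finset (Fin n)) = 3 :=
          card_eq_three.2 ⟨i, k, l, hik, hij ▸ hjl, hkl, rfl⟩
        rw [← this]
        exact card_le_card fun x => by simp only [mem_insert, mem_singleton]; tauto
      · by_cases hkj : k = j
        · have hil : i ≠ l := fun h => h2 ⟨h, hkj⟩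
          have : #({i, j, l} : Finset (Fin n)) = 3 :=
            card_eq_three.2 ⟨i, j, l, hij, hil, hjl, rfl⟩
          rw [← this]
          exact card_le_card fun x => by simp only [mem_insert, mem_singleton]; tauto
        · have : #({i, j, k} : Finset (Fin n)) = 3 :=
            card_eq_three.2 ⟨i, j, k, hij, hik, Ne.symm hkj, rfl⟩
          rw [← this]
          exact card_le_card fun x => by simp only [mem_insert, mem_singleton]; tauto
    have hle : #({i, j, k, l} : Finset (Fin n)) ≤ n := by
      simpa using card_le_univ ({i, j, k, l} : Finset (Fin n))
    have hcard := card_compl ({i, j, k, l} : Finset (Fin n))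
    rw [Fintype.card_fin] at hcard
    rw [pow_eq_zero_of_le (by omega)
      (sum_pow_card_of_sq_eq_zero (fun s => E s s) (fun s => hrow s s s) {i, j, k, l}ᶜ).2,
      mul_zero]
  · intro t ht
    simp only [mem_insert, mem_singleton] at ht
    rcases ht with rfl | rfl | rfl | rfl
    · rw [mul_right_comm, hrow, zero_mul]
    · rw [mul_right_comm, hcol, zero_mul]
    · rw [mul_assoc, hrow, mul_zero]
    · rw [mul_assoc, hcol, mul_zero]

theorem mul_mul_sum_diag_pow_eq_smul {K : Type*} [CommRing K] [Algebra K R] {n : ℕ} (hn : 1 < n)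
    (E : Fin n → Fin n → R) (hrow : ∀ i j l, E i j * E i l = 0)
    (hcol : ∀ i k j, E i j * E k j = 0)
    (hswap : ∀ i j k l, E i j * E k l = -(E i l * E k j)) (i j k l : Fin n) :
    E i j * E k l * (∑ s, E s s) ^ (n - 2) =
      (((if i = j then if k = l then 1 else 0 else 0) -
        (if i = l then if k = j then 1 else 0 else 0) : K) * ((n - 2).factorial : K)) •
        ∏ s, E s s := by
  rw [mul_mul_sum_diag_pow hn E hrow hcol hswap, mul_smul, Nat.cast_smul_eq_nsmul, nsmul_eq_mul]
  simp only [← ite_and]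
  split_ifs <;> simp

end CommutativeAlgebra

section PositiveSemidefinite

open Matrix
open scoped MatrixOrder Matrix.Norms.L2Operator

variable {ι : Type*} [Fintype ι]

theorem sum_sum_sum_sum_comm (f : ι → ι → ι → ι → ℂ) :
    ∑ i, ∑ j, ∑ k, ∑ l, f i j k l = ∑ k, ∑ l, ∑ i, ∑ j, f i j k l := by
  calc _ = ∑ i, ∑ k, ∑ l, ∑ j, f i j k l := by
        refine Finset.sum_congr rfl fun i _ => ?_
        rw [Finset.sum_comm]
        exact Finset.sum_congr rfl fun k _ => Finset.sum_comm
    _ = _ := by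
        rw [Finset.sum_comm]
        exact Finset.sum_congr rfl fun k _ => Finset.sum_comm

/-- Lagrange's identity for a pair of Gram matrices. -/
theorem sum_star_minor_mul_minor (M N : Matrix ι ι ℂ) :
    ∑ k, ∑ l, ∑ i, ∑ j, star (M k i * N l j - M k j * N l i) * (M k i * N l j - M k j * N l i) =
      2 * ((Mᴴ * M).trace * (Nᴴ * N).trace - (Mᴴ * M * (Nᴴ * N)).trace) := by
  have h1 : (Mᴴ * M).trace * (Nᴴ * N).trace =
      ∑ k, ∑ l, ∑ i, ∑ j, star (M k i * N l j) * (M k i * N l j) := by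
    simp only [trace, diag_apply, mul_apply, conjTranspose_apply]
    rw [Finset.sum_comm, Finset.sum_comm (s := Finset.univ (α := ι)) (f := fun i j => star (N j i) * N j i),
      Finset.sum_mul_sum]
    refine Finset.sum_congr rfl fun k _ => Finset.sum_congr rfl fun l _ => ?_
    rw [Finset.sum_mul_sum]
    refine Finset.sum_congr rfl fun i _ => Finset.sum_congr rfl fun j _ => ?_
    rw [star_mul']
    ring
  have h2 : (Mᴴ * M * (Nᴴ * N)).trace =
      ∑ k, ∑ l, ∑ i, ∑ j, star (M k i * N l j) * (M k j * N l i) := by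
    simp only [trace, diag_apply, mul_apply, conjTranspose_apply, Finset.sum_mul_sum]
    rw [sum_sum_sum_sum_comm]
    refine Finset.sum_congr rfl fun k _ => Finset.sum_congr rfl fun l _ =>
      Finset.sum_congr rfl fun i _ => Finset.sum_congr rfl fun j _ => ?_
    rw [star_mul']
    ring
  have h3 : ∀ f : ι → ι → ι → ι → ℂ,
      ∑ k, ∑ l, ∑ i, ∑ j, f k l j i = ∑ k, ∑ l, ∑ i, ∑ j, f k l i j := fun f =>
    Finset.sum_congr rfl fun k _ => Finset.sum_congr rfl fun l _ => Finset.sum_comm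
  calc _ = ∑ k, ∑ l, ∑ i, ∑ j, star (M k i * N l j) * (M k i * N l j)
        - ∑ k, ∑ l, ∑ i, ∑ j, star (M k i * N l j) * (M k j * N l i)
        + (∑ k, ∑ l, ∑ i, ∑ j, star (M k j * N l i) * (M k j * N l i)
        - ∑ k, ∑ l, ∑ i, ∑ j, star (M k j * N l i) * (M k i * N l j)) := by
        simp only [← Finset.sum_sub_distrib, ← Finset.sum_add_distrib]
        refine Finset.sum_congr rfl fun k _ => Finset.sum_congr rfl fun l _ =>
          Finset.sum_congr rfl fun i _ => Finset.sum_congr rfl fun j _ => ?_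
        rw [star_sub]
        ring
    _ = _ := by
        rw [h3 fun k l i j => star (M k i * N l j) * (M k i * N l j),
          h3 fun k l i j => star (M k i * N l j) * (M k j * N l i), ← h1, ← h2]
        ring

theorem Matrix.PosSemidef.mul_apply_comm_of_trace_mul_eq {A B : Matrix ι ι ℂ}
    (hA : A.PosSemidef) (hB : B.PosSemidef) (h : A.trace * B.trace = (A * B).trace)
    (i j r s : ι) : A i j * B r s = A i s * B r j := by
  classical
  obtain ⟨M, rfl⟩ := CStarAlgebra.nonneg_iff_eq_star_mul_self.1 hA.nonneg
  rw [star_eq_conjTranspose] at *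
  obtain ⟨N, rfl⟩ := CStarAlgebra.nonneg_iff_eq_star_mul_self.1 hB.nonneg
  rw [star_eq_conjTranspose] at *
  have hsum := sum_star_minor_mul_minor M N
  rw [h, sub_self, mul_zero] at hsum
  have nonneg : ∀ z : ℂ, 0 ≤ star z * z := fun z => star_mul_self_nonneg z
  have hminor : ∀ k l i j, M k i * N l j = M k j * N l i := by
    intro k l i j
    have e1 := (Finset.sum_eq_zero_iff_of_nonneg fun k _ => Finset.sum_nonneg fun l _ =>
      Finset.sum_nonneg fun i _ => Finset.sum_nonneg fun j _ => nonneg _).1 hsum k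
      (Finset.mem_univ _)
    have e2 := (Finset.sum_eq_zero_iff_of_nonneg fun l _ =>
      Finset.sum_nonneg fun i _ => Finset.sum_nonneg fun j _ => nonneg _).1 e1 l
      (Finset.mem_univ _)
    have e3 := (Finset.sum_eq_zero_iff_of_nonneg fun i _ =>
      Finset.sum_nonneg fun j _ => nonneg _).1 e2 i (Finset.mem_univ _)
    have e4 := (Finset.sum_eq_zero_iff_of_nonneg fun j _ => nonneg _).1 e3 j
      (Finset.mem_univ _)
    exact sub_eq_zero.1 ((mul_eq_zero.1 e4).elim star_eq_zero.1 id)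
  simp only [mul_apply, conjTranspose_apply, Finset.sum_mul_sum]
  refine Finset.sum_congr rfl fun k _ => Finset.sum_congr rfl fun l _ => ?_
  linear_combination star (M k i) * star (N l r) * hminor k l j s

end PositiveSemidefinite

section ExteriorAlgebra

open ExteriorAlgebra

variable {K W : Type*} [CommRing K] [AddCommGroup W] [Module K W]

theorem ExteriorAlgebra.ι_mul_ι_swap (a b : W) : ι K a * ι K b = -(ι K b * ι K a) :=
  eq_neg_of_add_eq_zero_left (ι_add_mul_swap a b)

theorem ExteriorAlgebra.ι_mul_ι_mem_center (a b : W) :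
    ι K a * ι K b ∈ Subalgebra.center K (ExteriorAlgebra K W) := by
  rw [Subalgebra.mem_center_iff]
  intro x
  induction x using ExteriorAlgebra.induction with
  | algebraMap r => exact Algebra.commutes r _
  | ι c =>
    rw [← mul_assoc, ι_mul_ι_swap c a, neg_mul, mul_assoc, ι_mul_ι_swap c b, mul_neg, neg_neg,
      mul_assoc]
  | mul x y hx hy => rw [mul_assoc, hy, ← mul_assoc, hx, mul_assoc]
  | add x y hx hy => rw [add_mul, mul_add, hx, hy]

/-- The decomposable bivector `a ∧ b` as an element of the commutative algebra of central
elements. -/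
def ExteriorAlgebra.centralWedge (a b : W) : Subalgebra.center K (ExteriorAlgebra K W) :=
  ⟨ι K a * ι K b, ι_mul_ι_mem_center a b⟩

theorem ExteriorAlgebra.centralWedge_mul_swap (a b c d : W) :
    centralWedge (K := K) a b * centralWedge c d = -(centralWedge a d * centralWedge c b) := by
  apply Subtype.ext
  change ι K a * ι K b * (ι K c * ι K d) = -(ι K a * ι K d * (ι K c * ι K b))
  rw [mul_assoc, mul_assoc, ← mul_neg, ← mul_assoc (ι K b), ι_mul_ι_swap b c, neg_mul, mul_assoc,
    ι_mul_ι_swap b d]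
  simp only [mul_neg, neg_neg]
  rw [← mul_assoc (ι K c), ι_mul_ι_swap c d, neg_mul, mul_neg, mul_assoc (ι K d)]

theorem ExteriorAlgebra.centralWedge_mul_left (a b d : W) :
    centralWedge (K := K) a b * centralWedge a d = 0 := by
  apply Subtype.ext
  change ι K a * ι K b * (ι K a * ι K d) = 0
  rw [mul_assoc, ← mul_assoc (ι K b), ι_mul_ι_swap b a, neg_mul, mul_neg, mul_assoc,
    ← mul_assoc, ι_sq_zero, zero_mul, neg_zero]

theorem ExteriorAlgebra.centralWedge_mul_right (a b c : W) :
    centralWedge (K := K) a b * centralWedge c b = 0 := by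
  apply Subtype.ext
  change ι K a * ι K b * (ι K c * ι K b) = 0
  rw [mul_assoc, ← mul_assoc (ι K b), ι_mul_ι_swap b c, neg_mul, mul_assoc, ι_sq_zero, mul_zero,
    neg_zero, mul_zero]

theorem ExteriorAlgebra.prod_centralWedge_ne_zero [Nontrivial K] {J : Type*} (z w : J → W)
    (d e : J → Module.Dual K W) (hdz : ∀ j, d j (z j) = 1) (hew : ∀ j, e j (w j) = 1)
    (hez : ∀ i j, e i (z j) = 0) (hdw : ∀ i j, d i (w j) = 0)
    (hdz' : ∀ i j, i ≠ j → d i (z j) = 0) (hew' : ∀ i j, i ≠ j → e i (w j) = 0)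
    (S : Finset J) : ∏ j ∈ S, centralWedge (K := K) (z j) (w j) ≠ 0 := by
  classical
  have coe_insert : ∀ (a : J) (S : Finset J), a ∉ S →
      ((∏ j ∈ insert a S, centralWedge (K := K) (z j) (w j) :
        Subalgebra.center K (ExteriorAlgebra K W)) : ExteriorAlgebra K W) =
      ι K (z a) * (ι K (w a) * (∏ j ∈ S, centralWedge (K := K) (z j) (w j) :
        Subalgebra.center K (ExteriorAlgebra K W))) := by
    intro a S ha
    rw [Finset.prod_insert ha]
    exact mul_assoc _ _ _
  have contract : ∀ (f : Module.Dual K W) (a : W) (x : ExteriorAlgebra K W),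
      CliffordAlgebra.contractLeft f (ι K a * x) =
        f a • x - ι K a * CliffordAlgebra.contractLeft f x := fun f a x =>
    CliffordAlgebra.contractLeft_ι_mul (Q := (0 : QuadraticForm K W)) f a x
  have vanish : ∀ (f : Module.Dual K W) (S : Finset J), (∀ j ∈ S, f (z j) = 0) →
      (∀ j ∈ S, f (w j) = 0) → CliffordAlgebra.contractLeft f
        ((∏ j ∈ S, centralWedge (K := K) (z j) (w j) :
          Subalgebra.center K (ExteriorAlgebra K W)) : ExteriorAlgebra K W) = 0 := by
    intro f S hz hw
    induction S using Finset.induction_on with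
    | empty =>
      rw [Finset.prod_empty]
      exact CliffordAlgebra.contractLeft_one (Q := (0 : QuadraticForm K W)) f
    | insert a S ha ih =>
      rw [coe_insert a S ha, contract, contract, hz a (by simp), hw a (by simp),
        ih (fun j hj => hz j (by simp [hj])) (fun j hj => hw j (by simp [hj]))]
      simp
  induction S using Finset.induction_on with
  | empty =>
    rw [Finset.prod_empty]
    exact one_ne_zero
  | insert a S ha ih =>
    intro h0
    apply ih
    have ne : ∀ j ∈ S, a ≠ j := fun j hj h => ha (h ▸ hj)
    have h1 := congrArg (fun x : Subalgebra.center K (ExteriorAlgebra K W) =>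
      CliffordAlgebra.contractLeft (e a) (CliffordAlgebra.contractLeft (d a)
        (x : ExteriorAlgebra K W))) h0
    simp only [coe_insert a S ha] at h1
    rw [contract, contract, vanish (d a) S (fun j hj => hdz' a j (ne j hj)) (fun j _ => hdw a j),
      hdz, hdw, zero_smul, mul_zero, sub_zero, mul_zero, sub_zero, one_smul, contract,
      vanish (e a) S (fun j _ => hez a j) (fun j hj => hew' a j (ne j hj)), hew, one_smul,
      mul_zero, sub_zero] at h1
    apply Subtype.ext
    simpa using h1

end ExteriorAlgebra

section Coordinates

variable {n : ℕ}

/-- The `(1,1)`-form `ζ_i ∧ ζ̄_j` as a central element of the exterior algebra. -/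
def zetaWedge (i j : Fin n) : Subalgebra.center ℂ (ExtAlg n) :=
  ExteriorAlgebra.centralWedge (zeta n i) (zetaBar n j)

theorem prod_zetaWedge_ne_zero : ∏ s : Fin n, zetaWedge s s ≠ 0 := by
  let ev (v : Em n) : Module.Dual ℂ (Wc n) :=
    { toFun := fun f => f v, map_add' := fun _ _ => rfl, map_smul' := fun _ _ => rfl }
  let x (i : Fin n) : Em n := EuclideanSpace.single i 1
  let y (i : Fin n) : Em n := EuclideanSpace.single i Complex.I
  refine ExteriorAlgebra.prod_centralWedge_ne_zero (K := ℂ) (zeta n) (zetaBar n)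
    (fun i => (1 / 2 : ℂ) • (ev (x i) - Complex.I • ev (y i)))
    (fun i => (1 / 2 : ℂ) • (ev (x i) + Complex.I • ev (y i))) ?_ ?_ ?_ ?_ ?_ ?_ Finset.univ
  · intro j
    simp [ev, x, y, zeta]
    norm_num
  · intro j
    simp [ev, x, y, zeta, zetaBar]
    norm_num
  · intro i j
    by_cases h : j = i <;> simp [ev, x, y, zeta, h]
  · intro i j
    by_cases h : j = i <;> simp [ev, x, y, zeta, zetaBar, h]
  · intro i j h
    simp [ev, x, y, zeta, h.symm]
  · intro i j h
    simp [ev, x, y, zeta, zetaBar, h.symm]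

theorem form11_eq_coe (A : Matrix (Fin n) (Fin n) ℂ) :
    form11 n A = ((Complex.I • ∑ i, ∑ j, A i j • zetaWedge i j :
      Subalgebra.center ℂ (ExtAlg n)) : ExtAlg n) := by
  simp [form11, zetaWedge, ExteriorAlgebra.centralWedge]

theorem eta_eq_coe :
    eta n = ((Complex.I • ∑ j, zetaWedge j j : Subalgebra.center ℂ (ExtAlg n)) : ExtAlg n) := by
  simp [eta, zetaWedge, ExteriorAlgebra.centralWedge]

theorem sum_smul_mul_sum_smul {R : Type*} [CommRing R] [Algebra ℂ R]
    (A B : Matrix (Fin n) (Fin n) ℂ) (E : Fin n → Fin n → R) :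
    (∑ i, ∑ j, A i j • E i j) * (∑ k, ∑ l, B k l • E k l) =
      ∑ i, ∑ k, ∑ j, ∑ l, (A i j * B k l) • (E i j * E k l) := by
  rw [Finset.sum_mul_sum]
  refine Finset.sum_congr rfl fun i _ => Finset.sum_congr rfl fun k _ => ?_
  rw [Finset.sum_mul_sum]
  refine Finset.sum_congr rfl fun j _ => Finset.sum_congr rfl fun l _ => ?_
  rw [smul_mul_smul_comm]

theorem trace_mul_trace_eq_of_wedge_eq_zero (hn : 1 < n) (A B : Matrix (Fin n) (Fin n) ℂ)
    (h : form11 n A * form11 n B * eta n ^ (n - 2) = 0) :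
    A.trace * B.trace = (A * B).trace := by
  rw [form11_eq_coe, form11_eq_coe, eta_eq_coe] at h
  replace h : (Complex.I • ∑ i, ∑ j, A i j • zetaWedge i j) *
      (Complex.I • ∑ i, ∑ j, B i j • zetaWedge i j) *
      (Complex.I • ∑ j, zetaWedge (n := n) j j) ^ (n - 2) = 0 := Subtype.ext h
  rw [smul_mul_smul_comm, smul_pow, smul_mul_smul_comm, sum_smul_mul_sum_smul] at h
  replace h := (smul_eq_zero.1 h).resolve_left (by simp)
  simp only [Finset.sum_mul, smul_mul_assoc] at h
  simp only [mul_mul_sum_diag_pow_eq_smul (K := ℂ) hn zetaWedge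
    (fun i j l => ExteriorAlgebra.centralWedge_mul_left _ _ _)
    (fun i k j => ExteriorAlgebra.centralWedge_mul_right _ _ _)
    (fun i j k l => ExteriorAlgebra.centralWedge_mul_swap _ _ _ _)] at h
  simp only [smul_smul, ← mul_assoc, ← Finset.sum_smul, ← Finset.sum_mul] at h
  replace h := (smul_eq_zero.1 h).resolve_right prod_zetaWedge_ne_zero
  replace h := (mul_eq_zero.1 h).resolve_right (by exact_mod_cast Nat.factorial_ne_zero _)
  simp only [mul_sub, Finset.sum_sub_distrib, mul_ite, mul_one, mul_zero] at h
  rw [sub_eq_zero] at h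
  simp only [Matrix.trace, Matrix.diag_apply, Matrix.mul_apply, Finset.sum_mul_sum]
  simpa using h

end Coordinates

/-- Lemma 5.1(b): if `α ≥ 0`, `β ≥ 0` are real skew-symmetric `(1,1)`-forms on an
`n`-dimensional (`n > 1`) Hermitian inner product space and `α ∧ β ∧ η^(n-2) = 0`, then
`α ∧ β = 0`.  Forms are written `α = i Σ A_{ij} ζ_i ∧ ζ̄_j` in unitary coordinates, so
nonnegativity is positive semidefiniteness of the Hermitian coefficient matrix. -/
theorem statement0 (n : ℕ) (hn : 1 < n) (A B : Matrix (Fin n) (Fin n) ℂ)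
    (hA : A.PosSemidef) (hB : B.PosSemidef)
    (h : form11 n A * form11 n B * eta n ^ (n - 2) = 0) :
    form11 n A * form11 n B = 0 := by
  have hsymm := hA.mul_apply_comm_of_trace_mul_eq hB (trace_mul_trace_eq_of_wedge_eq_zero hn A B h)
  rw [form11_eq_coe, form11_eq_coe]
  suffices h0 : (∑ i, ∑ j, A i j • zetaWedge i j) * (∑ k, ∑ l, B k l • zetaWedge k l) = 0 by
    rw [← MulMemClass.coe_mul, smul_mul_smul_comm, h0, smul_zero, ZeroMemClass.coe_zero]
  rw [sum_smul_mul_sum_smul]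
  refine Finset.sum_eq_zero fun i _ => Finset.sum_eq_zero fun k _ => ?_
  have hneg : ∑ j, ∑ l, (A i j * B k l) • (zetaWedge i j * zetaWedge k l) =
      -∑ j, ∑ l, (A i j * B k l) • (zetaWedge i j * zetaWedge k l) := by
    conv_lhs => rw [Finset.sum_comm]
    simp only [← Finset.sum_neg_distrib]
    refine Finset.sum_congr rfl fun j _ => Finset.sum_congr rfl fun l _ => ?_
    rw [hsymm i l k j, ← smul_neg]
    congr 1
    exact ExteriorAlgebra.centralWedge_mul_swap _ _ _ _
  have := IsAddTorsionFree.of_module_rat (Subalgebra.center ℂ (ExtAlg n))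
  exact self_eq_neg.1 hneg
end
end

section
/- Let V be a complex vector space of dimension n > 1 with Hermitian inner product g and fundamental (1,1)-form η. Let ω_1 and ω_2 be forms of type (1,0) on V (i.e., complex-linear functionals), and set α = i ω_1 ∧ ω̄_1 and β = i ω_2 ∧ ω̄_2. If α ∧ β ∧ η^{n-2} = 0, then ω_1 ∧ ω_2 = 0. -/
set_option synthInstance.maxHeartbeats 1000000
set_option maxHeartbeats 1000000

set_option maxHeartbeats 1000000

open scoped BigOperators
noncomputable section

section SquareZero

variable {A : Type*} [Ring A] {x y : A}

/-- Powers of `x + y` when `x` commutes with `y` and squares to zero. -/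
lemma add_pow_succ_of_mul_self_eq_zero (hxy : Commute x y) (hx : x * x = 0) (m : ℕ) :
    (x + y) ^ (m + 1) = y ^ (m + 1) + (m + 1 : ℕ) • (x * y ^ m) := by
  induction m with
  | zero => simp [add_comm]
  | succ m ih =>
    have hxx : x * (x * y ^ m) = 0 := by rw [← mul_assoc, hx, zero_mul]
    have hyx : y * (x * y ^ m) = x * y ^ (m + 1) := by
      rw [← mul_assoc, ← hxy.eq, mul_assoc, ← pow_succ']
    rw [pow_succ', ih, add_mul, mul_add, mul_add, mul_smul_comm, mul_smul_comm, hxx, hyx,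
      smul_zero, add_zero, ← pow_succ', succ_nsmul _ (m + 1)]
    abel

lemma mul_add_pow_of_mul_self_eq_zero (hxy : Commute x y) (hx : x * x = 0) (m : ℕ) :
    x * (x + y) ^ m = x * y ^ m := by
  cases m with
  | zero => simp
  | succ m =>
    rw [add_pow_succ_of_mul_self_eq_zero hxy hx, mul_add, mul_smul_comm, ← mul_assoc x x, hx,
      zero_mul, smul_zero, add_zero]

end SquareZero

namespace ExteriorAlgebra

open CliffordAlgebra (contractLeft contractLeft_ι_mul contractLeft_one)

variable {K M J : Type*} [Field K] [AddCommGroup M] [Module K M]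

lemma ι_mul_ι_eq_neg (u v : M) : ι K u * ι K v = -(ι K v * ι K u) :=
  eq_neg_of_add_eq_zero_left (ι_add_mul_swap u v)

lemma commute_ι_mul_ι_ι (u v w : M) : Commute (ι K u * ι K v) (ι K w) := by
  rw [Commute, SemiconjBy, mul_assoc, ι_mul_ι_eq_neg v w, mul_neg, ← mul_assoc,
    ι_mul_ι_eq_neg u w, neg_mul, neg_neg, mul_assoc]

lemma commute_ι_mul_ι (u v w z : M) : Commute (ι K u * ι K v) (ι K w * ι K z) :=
  (commute_ι_mul_ι_ι u v w).mul_right (commute_ι_mul_ι_ι u v z)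

lemma ι_mul_ι_mul_self (u v : M) : ι K u * ι K v * (ι K u * ι K v) = 0 := by
  rw [← mul_assoc, (commute_ι_mul_ι_ι u v u).eq, ← mul_assoc, ι_sq_zero, zero_mul, zero_mul]

lemma commute_ι_mul_ι_sum (u v : J → M) (j : J) (S : Finset J) :
    Commute (ι K (u j) * ι K (v j)) (∑ i ∈ S, ι K (u i) * ι K (v i)) :=
  Commute.sum_right _ _ _ fun i _ => commute_ι_mul_ι (u j) (v j) (u i) (v i)

lemma contractLeft_ι_mul_ι_mul {d : Module.Dual K M} {u v : M} (hu : d u = 0) (hv : d v = 0)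
    (B : ExteriorAlgebra K M) :
    contractLeft (Q := (0 : QuadraticForm K M)) d (ι K u * ι K v * B) =
      ι K u * ι K v * contractLeft (Q := (0 : QuadraticForm K M)) d B := by
  rw [mul_assoc]
  erw [contractLeft_ι_mul, contractLeft_ι_mul]
  simp only [hu, hv, zero_smul, zero_sub, mul_neg, neg_neg]
  exact (mul_assoc _ _ _).symm

lemma contractLeft_sum_pow {d : Module.Dual K M} {u v : J → M} {S : Finset J}
    (hu : ∀ i ∈ S, d (u i) = 0) (hv : ∀ i ∈ S, d (v i) = 0) (m : ℕ) :
    contractLeft (Q := (0 : QuadraticForm K M)) d ((∑ i ∈ S, ι K (u i) * ι K (v i)) ^ m) = 0 := by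
  induction m with
  | zero => rw [pow_zero]; exact contractLeft_one (Q := (0 : QuadraticForm K M)) d
  | succ m ih =>
    rw [pow_succ', Finset.sum_mul, map_sum]
    refine Finset.sum_eq_zero fun i hi => ?_
    rw [contractLeft_ι_mul_ι_mul (hu i hi) (hv i hi), ih, mul_zero]

/-- If `d`, `d'` are dual to `u`, `v` and annihilate `B`, then `B` is recovered from `u ∧ v ∧ B`. -/
lemma eq_zero_of_ι_mul_ι_mul_eq_zero {d d' : Module.Dual K M} {u v : M} {B : ExteriorAlgebra K M}
    (hu : d u = 1) (hv : d v = 0) (hv' : d' v = 1)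
    (hB : contractLeft (Q := (0 : QuadraticForm K M)) d B = 0)
    (hB' : contractLeft (Q := (0 : QuadraticForm K M)) d' B = 0)
    (h : ι K u * ι K v * B = 0) : B = 0 := by
  have h1 : contractLeft (Q := (0 : QuadraticForm K M)) d (ι K u * (ι K v * B)) = ι K v * B := by
    erw [contractLeft_ι_mul, contractLeft_ι_mul]
    simp [hu, hv, hB]
  have h2 : contractLeft (Q := (0 : QuadraticForm K M)) d' (ι K v * B) = B := by
    erw [contractLeft_ι_mul]
    simp [hv', hB']
  rw [← h2, ← h1, ← mul_assoc, h, map_zero, map_zero]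

lemma sum_ι_mul_ι_pow_card_succ (u v : J → M) (S : Finset J) :
    (∑ i ∈ S, ι K (u i) * ι K (v i)) ^ (S.card + 1) = 0 := by
  classical
  induction S using Finset.induction_on with
  | empty => simp
  | insert j S hj ih =>
    rw [Finset.sum_insert hj, Finset.card_insert_of_notMem hj,
      add_pow_succ_of_mul_self_eq_zero (commute_ι_mul_ι_sum u v j S) (ι_mul_ι_mul_self _ _),
      ih, pow_succ, ih]
    simp

variable [DecidableEq J] {u v : J → M} {d d' : J → Module.Dual K M}

lemma sum_ι_mul_ι_pow_card_ne_zero [CharZero K]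
    (hu : ∀ i j, d i (u j) = if i = j then 1 else 0) (hv : ∀ i j, d i (v j) = 0)
    (hu' : ∀ i j, d' i (u j) = 0) (hv' : ∀ i j, d' i (v j) = if i = j then 1 else 0)
    (S : Finset J) : (∑ i ∈ S, ι K (u i) * ι K (v i)) ^ S.card ≠ 0 := by
  induction S using Finset.induction_on with
  | empty => simp
  | insert j S hj ih =>
    have hne : ∀ i ∈ S, j ≠ i := fun i hi hji => hj (hji ▸ hi)
    rw [Finset.sum_insert hj, Finset.card_insert_of_notMem hj,
      add_pow_succ_of_mul_self_eq_zero (commute_ι_mul_ι_sum u v j S) (ι_mul_ι_mul_self _ _),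
      sum_ι_mul_ι_pow_card_succ, zero_add, ← Nat.cast_smul_eq_nsmul K]
    refine smul_ne_zero (Nat.cast_ne_zero.2 S.card.succ_ne_zero) fun h => ih ?_
    refine eq_zero_of_ι_mul_ι_mul_eq_zero (u := u j) (v := v j) (d := d j) (d' := d' j) (by simp [hu]) (hv j j)
      (by simp [hv']) ?_ ?_ h
    · exact contractLeft_sum_pow (fun i hi => by simp [hu, hne i hi]) (fun i _ => hv j i) _
    · exact contractLeft_sum_pow (fun i _ => hu' j i) (fun i hi => by simp [hv', hne i hi]) _

/-- In a space with coordinates `u`, `v`, the form `u_j ∧ v_j ∧ u_k ∧ v_k` has nonzero wedge product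
with the complementary power of `∑ u_i ∧ v_i`. -/
lemma ι_mul_ι_mul_sum_pow_ne_zero [CharZero K] [Fintype J]
    (hu : ∀ i j, d i (u j) = if i = j then 1 else 0) (hv : ∀ i j, d i (v j) = 0)
    (hu' : ∀ i j, d' i (u j) = 0) (hv' : ∀ i j, d' i (v j) = if i = j then 1 else 0)
    {j k : J} (hjk : j ≠ k) :
    ι K (u j) * ι K (v j) * (ι K (u k) * ι K (v k)) *
      (∑ i, ι K (u i) * ι K (v i)) ^ (Fintype.card J - 2) ≠ 0 := by
  set S : Finset J := (Finset.univ.erase j).erase k with hS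
  have hk : k ∈ Finset.univ.erase j := by simp [hjk.symm]
  have hcard : Fintype.card J - 2 = S.card := by
    rw [hS, Finset.card_erase_of_mem hk, Finset.card_erase_of_mem (Finset.mem_univ j),
      Finset.card_univ, Nat.sub_sub]
  have hjS : ∀ i ∈ S, j ≠ i := by simp +contextual [hS, eq_comm]
  have hkS : ∀ i ∈ S, k ≠ i := by simp +contextual [hS, eq_comm]
  rw [hcard, ← Finset.add_sum_erase _ _ (Finset.mem_univ j),
    (commute_ι_mul_ι (u j) (v j) (u k) (v k)).eq, mul_assoc,
    mul_add_pow_of_mul_self_eq_zero (commute_ι_mul_ι_sum u v j _) (ι_mul_ι_mul_self _ _),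
    ← mul_assoc, ← (commute_ι_mul_ι (u j) (v j) (u k) (v k)).eq, mul_assoc,
    ← Finset.add_sum_erase _ _ hk,
    mul_add_pow_of_mul_self_eq_zero (commute_ι_mul_ι_sum u v k _) (ι_mul_ι_mul_self _ _), ← hS]
  intro h
  have hd : ∀ l, (∀ i ∈ S, l ≠ i) → contractLeft (Q := (0 : QuadraticForm K M)) (d l)
      ((∑ i ∈ S, ι K (u i) * ι K (v i)) ^ S.card) = 0 := fun l hl =>
    contractLeft_sum_pow (fun i hi => by simp [hu, hl i hi]) (fun i _ => hv l i) _
  have hd' : ∀ l, (∀ i ∈ S, l ≠ i) → contractLeft (Q := (0 : QuadraticForm K M)) (d' l)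
      ((∑ i ∈ S, ι K (u i) * ι K (v i)) ^ S.card) = 0 := fun l hl =>
    contractLeft_sum_pow (fun i _ => hu' l i) (fun i hi => by simp [hv', hl i hi]) _
  refine sum_ι_mul_ι_pow_card_ne_zero hu hv hu' hv' S ?_
  refine eq_zero_of_ι_mul_ι_mul_eq_zero (u := u k) (v := v k) (d := d k) (d' := d' k) (by simp [hu]) (hv k k)
    (by simp [hv']) (hd k hkS) (hd' k hkS) ?_
  refine eq_zero_of_ι_mul_ι_mul_eq_zero (u := u j) (v := v j) (d := d j) (d' := d' j) (by simp [hu]) (hv j j)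
    (by simp [hv']) ?_ ?_ h
  · rw [contractLeft_ι_mul_ι_mul (by simp [hu, hjk]) (hv j k), hd j hjS, mul_zero]
  · rw [contractLeft_ι_mul_ι_mul (hu' j k) (by simp [hv', hjk]), hd' j hjS, mul_zero]

end ExteriorAlgebra

open ExteriorAlgebra in
/-- For `ω₁ = p u` and `ω₂ = q u + r w`, the form `ω₁ ∧ ω̄₁ ∧ ω₂ ∧ ω̄₂` is a multiple of
`u ∧ ū ∧ w ∧ w̄`. -/
lemma ι_smul_mul_ι_add_smul {K M : Type*} [Field K] [AddCommGroup M] [Module K M]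
    (u u' w w' : M) (p p' q q' r r' : K) :
    (p • ι K u) * (p' • ι K u') * ((q • ι K u + r • ι K w) * (q' • ι K u' + r' • ι K w')) =
      (p * p' * (r * r')) • (ι K u * ι K u' * (ι K w * ι K w')) := by
  have h1 : ι K u * ι K u' * ι K u = 0 := by
    rw [(commute_ι_mul_ι_ι u u' u).eq, ← mul_assoc, ι_sq_zero, zero_mul]
  have h2 : ι K u * ι K u' * (ι K w * ι K u') = 0 := by
    rw [ι_mul_ι_eq_neg w u', mul_neg, ← mul_assoc, mul_assoc (ι K u), ι_sq_zero, mul_zero,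
      zero_mul, neg_zero]
  simp only [add_mul, mul_add, smul_mul_smul_comm, h2, ← mul_assoc, h1, zero_mul, smul_zero,
    zero_add]

/-- The `(1,0)`-covector `Σ a_j ζ_j`. -/
def covec10 (n : ℕ) (a : Fin n → ℂ) : Wc n := ∑ j, a j • zeta n j

/-- The `(0,1)`-covector `Σ ā_j ζ̄_j`. -/
def covec01 (n : ℕ) (a : Fin n → ℂ) : Wc n := ∑ j, starRingEnd ℂ (a j) • zetaBar n j

lemma covec10_apply (n : ℕ) (a : Fin n → ℂ) (x : Em n) : covec10 n a x = ∑ j, a j * x j := by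
  simp [covec10, zeta, LinearMap.sum_apply]

lemma covec01_apply (n : ℕ) (a : Fin n → ℂ) (x : Em n) :
    covec01 n a x = ∑ j, starRingEnd ℂ (a j) * starRingEnd ℂ (x j) := by
  simp [covec01, zetaBar, zeta, LinearMap.sum_apply]

/-- The complex-linear part of a covector, evaluated at `x`. -/
def evalLinear (n : ℕ) (x : Em n) : Module.Dual ℂ (Wc n) where
  toFun f := (f x - Complex.I * f (Complex.I • x)) / 2
  map_add' f g := by simp; ring
  map_smul' c f := by simp; ring

/-- The conjugate-linear part of a covector, evaluated at `x`. -/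
def evalAntilinear (n : ℕ) (x : Em n) : Module.Dual ℂ (Wc n) where
  toFun f := (f x + Complex.I * f (Complex.I • x)) / 2
  map_add' f g := by simp; ring
  map_smul' c f := by simp; ring

lemma covec10_I_smul (n : ℕ) (a : Fin n → ℂ) (x : Em n) :
    covec10 n a (Complex.I • x) = Complex.I * covec10 n a x := by
  simp only [covec10_apply, Finset.mul_sum]
  exact Finset.sum_congr rfl fun j _ => by simp; ring

lemma covec01_I_smul (n : ℕ) (a : Fin n → ℂ) (x : Em n) :
    covec01 n a (Complex.I • x) = -(Complex.I * covec01 n a x) := by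
  simp only [covec01_apply, Finset.mul_sum, ← Finset.sum_neg_distrib]
  exact Finset.sum_congr rfl fun j _ => by simp; ring

lemma evalLinear_covec10 (n : ℕ) (a : Fin n → ℂ) (x : Em n) :
    evalLinear n x (covec10 n a) = covec10 n a x := by
  simp only [evalLinear, LinearMap.coe_mk, AddHom.coe_mk, covec10_I_smul]
  linear_combination (-covec10 n a x / 2) * Complex.I_mul_I

lemma evalLinear_covec01 (n : ℕ) (a : Fin n → ℂ) (x : Em n) :
    evalLinear n x (covec01 n a) = 0 := by
  simp only [evalLinear, LinearMap.coe_mk, AddHom.coe_mk, covec01_I_smul]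
  linear_combination (covec01 n a x / 2) * Complex.I_mul_I

lemma evalAntilinear_covec10 (n : ℕ) (a : Fin n → ℂ) (x : Em n) :
    evalAntilinear n x (covec10 n a) = 0 := by
  simp only [evalAntilinear, LinearMap.coe_mk, AddHom.coe_mk, covec10_I_smul]
  linear_combination (covec10 n a x / 2) * Complex.I_mul_I

lemma evalAntilinear_covec01 (n : ℕ) (a : Fin n → ℂ) (x : Em n) :
    evalAntilinear n x (covec01 n a) = covec01 n a x := by
  simp only [evalAntilinear, LinearMap.coe_mk, AddHom.coe_mk, covec01_I_smul]
  linear_combination (-covec01 n a x / 2) * Complex.I_mul_I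

/-- The vector with conjugate coordinates. -/
def conjVec (n : ℕ) (x : Em n) : Em n := WithLp.toLp 2 fun j => starRingEnd ℂ (x j)

lemma covec10_conjVec (n : ℕ) (x y : Em n) : covec10 n y (conjVec n x) = inner ℂ x y := by
  simp [covec10_apply, conjVec, PiLp.inner_apply]

lemma covec01_conjVec (n : ℕ) (x y : Em n) : covec01 n y (conjVec n x) = inner ℂ y x := by
  simp [covec01_apply, conjVec, PiLp.inner_apply, mul_comm]

lemma OrthonormalBasis.sum_apply_mul_conj {n : ℕ} (e : OrthonormalBasis (Fin n) ℂ (Em n))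
    (k l : Fin n) : ∑ j, e j k * starRingEnd ℂ (e j l) = if k = l then 1 else 0 := by
  have h := congrArg (fun x : Em n => x k) (e.sum_repr' (EuclideanSpace.single l 1))
  simpa [EuclideanSpace.inner_single_right, Pi.single_apply, mul_comm] using h

/-- The fundamental form has the same expression in every unitary coframe. -/
lemma eta_eq_sum_orthonormalBasis {n : ℕ} (e : OrthonormalBasis (Fin n) ℂ (Em n)) :
    eta n = Complex.I • ∑ j, ExteriorAlgebra.ι ℂ (covec10 n (e j)) *
      ExteriorAlgebra.ι ℂ (covec01 n (e j)) := by
  rw [eta]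
  congr 1
  simp only [covec10, covec01, map_sum, map_smul, Finset.sum_mul_sum, smul_mul_smul_comm]
  rw [Finset.sum_comm]
  refine Finset.sum_congr rfl fun k _ => ?_
  rw [Finset.sum_comm]
  simp only [← Finset.sum_smul, e.sum_apply_mul_conj]
  simp

/-- Lemma 5.1(e): if `ω_1, ω_2` are `(1,0)`-forms, `α = i ω_1 ∧ ω̄_1`,
`β = i ω_2 ∧ ω̄_2`, and `α ∧ β ∧ η^(n-2) = 0`, then `ω_1 ∧ ω_2 = 0`. -/
theorem statement3 (n : ℕ) (hn : 1 < n) (a b : Fin n → ℂ)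
    (h : (Complex.I • (form10 n a * form01 n a)) * (Complex.I • (form10 n b * form01 n b)) *
        eta n ^ (n - 2) = 0) :
    form10 n a * form10 n b = 0 := by
  obtain ⟨m, rfl⟩ : ∃ m, n = m + 2 := ⟨n - 2, by omega⟩
  let f : Fin (m + 2) → Em (m + 2) :=
    fun i => if i = 0 then WithLp.toLp 2 a else if i = 1 then WithLp.toLp 2 b else 0
  have hdim : Module.finrank ℂ (Em (m + 2)) = Fintype.card (Fin (m + 2)) := by simp
  set e := InnerProductSpace.gramSchmidtOrthonormalBasis hdim f
  have hz : ∀ i j : Fin (m + 2), i < j → inner ℂ (e j) (f i) = 0 := fun i j hij =>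
    InnerProductSpace.gramSchmidtOrthonormalBasis_inv_triangular hdim f hij
  have h01 : (0 : Fin (m + 2)) ≠ 1 := by simp
  set p := inner ℂ (e 0) (f 0)
  set q := inner ℂ (e 0) (f 1)
  set r := inner ℂ (e 1) (f 1)
  have ha : WithLp.toLp 2 a = p • e 0 := by
    have := e.sum_repr' (f 0)
    rw [Fin.sum_univ_succ, Finset.sum_eq_zero, add_zero] at this
    · simpa [f, p, q, r] using this.symm
    · intro i _
      rw [hz _ _ i.succ_pos, zero_smul]
  have hb : WithLp.toLp 2 b = q • e 0 + r • e 1 := by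
    have := e.sum_repr' (f 1)
    rw [Fin.sum_univ_succ, Fin.sum_univ_succ, Finset.sum_eq_zero, add_zero] at this
    · simpa [f, p, q, r] using this.symm
    · intro i _
      rw [hz _ _ (by simp [Fin.lt_def]), zero_smul]
  have ha' : ∀ j, a j = p * e 0 j := fun j => by
    simpa using congrArg (fun x : Em (m + 2) => x j) ha
  have hb' : ∀ j, b j = q * e 0 j + r * e 1 j := fun j => by
    simpa using congrArg (fun x : Em (m + 2) => x j) hb
  have hfa : form10 (m + 2) a = p • ExteriorAlgebra.ι ℂ (covec10 (m + 2) (e 0)) := by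
    simp [form10, covec10, ha', Finset.smul_sum, mul_smul]
  have hfa' : form01 (m + 2) a =
      starRingEnd ℂ p • ExteriorAlgebra.ι ℂ (covec01 (m + 2) (e 0)) := by
    simp [form01, covec01, ha', Finset.smul_sum, mul_smul]
  have hfb : form10 (m + 2) b = q • ExteriorAlgebra.ι ℂ (covec10 (m + 2) (e 0)) +
      r • ExteriorAlgebra.ι ℂ (covec10 (m + 2) (e 1)) := by
    simp [form10, covec10, hb', Finset.smul_sum, mul_smul, add_smul, Finset.sum_add_distrib]
  have hfb' : form01 (m + 2) b =
      starRingEnd ℂ q • ExteriorAlgebra.ι ℂ (covec01 (m + 2) (e 0)) +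
      starRingEnd ℂ r • ExteriorAlgebra.ι ℂ (covec01 (m + 2) (e 1)) := by
    simp [form01, covec01, hb', Finset.smul_sum, mul_smul, add_smul, Finset.sum_add_distrib]
  have hne := ExteriorAlgebra.ι_mul_ι_mul_sum_pow_ne_zero
    (u := fun j => covec10 (m + 2) (e j)) (v := fun j => covec01 (m + 2) (e j))
    (d := fun j => evalLinear (m + 2) (conjVec (m + 2) (e j)))
    (d' := fun j => evalAntilinear (m + 2) (conjVec (m + 2) (e j)))
    (fun i j => by
      rw [evalLinear_covec10, covec10_conjVec, orthonormal_iff_ite.1 e.orthonormal])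
    (fun i j => evalLinear_covec01 _ _ _) (fun i j => evalAntilinear_covec10 _ _ _)
    (fun i j => by
      rw [evalAntilinear_covec01, covec01_conjVec, orthonormal_iff_ite.1 e.orthonormal]
      simp only [eq_comm])
    h01
  rw [Fintype.card_fin] at hne
  rw [smul_mul_smul_comm, hfa, hfa', hfb, hfb', ι_smul_mul_ι_add_smul,
    eta_eq_sum_orthonormalBasis e, smul_pow, smul_smul, smul_mul_smul_comm] at h
  have hpr : p = 0 ∨ r = 0 := by
    simpa using (smul_eq_zero.1 h).resolve_right hne
  rw [hfa, hfb]
  rcases hpr with hp | hr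
  · simp [hp]
  · simp [hr]
end
end

section
/- Let V be a complex vector space of dimension n > 1 with Hermitian inner product g and fundamental form η. Let ω_1 be a (1,0)-form, α = i ω_1 ∧ ω̄_1, and let β be a nonnegative real skew-symmetric (1,1)-form. If α ∧ β ∧ η^{n-2} = 0, then ω_1 ∧ β = 0. -/
set_option synthInstance.maxHeartbeats 1000000
open scoped ComplexOrder
set_option maxHeartbeats 1000000

set_option maxHeartbeats 1000000

open scoped BigOperators
noncomputable section

theorem pairwise_commute {R κ : Type*} [Mul R] {e : κ → R} (hc : ∀ i j, Commute (e i) (e j)) (S : Set κ) :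
    S.Pairwise (Function.onFun Commute e) :=
  fun i _ j _ _ => hc i j

section SquareZero

variable {R κ : Type*} [Ring R] [Fintype κ] [DecidableEq κ]

/-- If `x` is annihilated by `e j` for more than `card κ - m` indices `j`, and the `e j` commute and
square to zero, then `x * (∑ j, e j) ^ m = 0`. -/
theorem mul_sum_pow_eq_zero {e : κ → R} (hc : ∀ i j, Commute (e i) (e j))
    (hs : ∀ j, e j * e j = 0) (m : ℕ) :
    ∀ (x : R) (T : Finset κ), (∀ j ∈ T, x * e j = 0) → Fintype.card κ < T.card + m →
      x * (∑ j, e j) ^ m = 0 := by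
  induction m with
  | zero =>
    intro x T _ hT
    have := T.card_le_univ
    omega
  | succ m ih =>
    intro x T hx hT
    rw [pow_succ', ← mul_assoc, Finset.mul_sum, Finset.sum_mul]
    refine Finset.sum_eq_zero fun j _ => ?_
    by_cases hj : j ∈ T
    · rw [hx j hj, zero_mul]
    · refine ih _ (insert j T) (fun k hk => ?_) (by rw [Finset.card_insert_of_notMem hj]; omega)
      rcases Finset.mem_insert.1 hk with rfl | hk
      · rw [mul_assoc, hs, mul_zero]
      · rw [mul_assoc, (hc j k).eq, ← mul_assoc, hx k hk, zero_mul]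

/-- For commuting square-zero elements, `(∏ j ∈ S, e j) * (∑ j, e j) ^ m = m! ∏ j, e j`
when `S` has `m` elements less than the index type. -/
theorem noncommProd_mul_sum_pow {e : κ → R} (hc : ∀ i j, Commute (e i) (e j))
    (hs : ∀ j, e j * e j = 0) (m : ℕ) :
    ∀ S : Finset κ, S.card + m = Fintype.card κ →
      S.noncommProd e (pairwise_commute hc _) * (∑ j, e j) ^ m =
        m.factorial • Finset.univ.noncommProd e (pairwise_commute hc _) := by
  induction m with
  | zero =>
    intro S hS
    obtain rfl : S = Finset.univ := (Finset.card_eq_iff_eq_univ S).1 (by simpa using hS)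
    simp
  | succ m ih =>
    intro S hS
    have key : ∀ j, S.noncommProd e (pairwise_commute hc _) * e j * (∑ j, e j) ^ m =
        if j ∈ S then 0 else
          m.factorial • Finset.univ.noncommProd e (pairwise_commute hc _) := by
      intro j
      split_ifs with hj
      · rw [← Finset.noncommProd_erase_mul S hj e (pairwise_commute hc _),
          mul_assoc _ (e j) (e j), hs, mul_zero, zero_mul]
      · rw [← ih (insert j S) (by rw [Finset.card_insert_of_notMem hj]; omega),
          Finset.noncommProd_insert_of_notMem' _ _ _ _ hj]
    rw [pow_succ', ← mul_assoc, Finset.mul_sum, Finset.sum_mul, Finset.sum_congr rfl fun j _ => key j,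
      Finset.sum_ite, Finset.sum_const_zero, zero_add, Finset.sum_const, ← mul_smul,
      Finset.filter_not, Finset.filter_mem_eq_inter, Finset.univ_inter, ← Finset.compl_eq_univ_sdiff,
      Finset.card_compl, Nat.factorial_succ, ← hS, Nat.add_sub_cancel_left]

end SquareZero

section Covectors

variable {n : ℕ}


theorem ι_mul_ι_anticomm (x y : Wc n) :
    ExteriorAlgebra.ι ℂ x * ExteriorAlgebra.ι ℂ y =
      -(ExteriorAlgebra.ι ℂ y * ExteriorAlgebra.ι ℂ x) :=
  eq_neg_of_add_eq_zero_left (ExteriorAlgebra.ι_add_mul_swap x y)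

theorem commute_ι_mul_ι (x y w : Wc n) :
    Commute (ExteriorAlgebra.ι ℂ x * ExteriorAlgebra.ι ℂ y) (ExteriorAlgebra.ι ℂ w) := by
  rw [commute_iff_eq, mul_assoc, ι_mul_ι_anticomm y w, mul_neg, ← mul_assoc,
    ι_mul_ι_anticomm x w, neg_mul, neg_neg, mul_assoc]

/-- The `(1,1)`-covector `ζ_j ∧ ζ̄_j`. -/
def zetaPair (n : ℕ) (j : Fin n) : ExtAlg n :=
  ExteriorAlgebra.ι ℂ (zeta n j) * ExteriorAlgebra.ι ℂ (zetaBar n j)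

theorem commute_zetaPair_ι (j : Fin n) (w : Wc n) :
    Commute (zetaPair n j) (ExteriorAlgebra.ι ℂ w) :=
  commute_ι_mul_ι _ _ w

theorem zetaPair_commute (i j : Fin n) : Commute (zetaPair n i) (zetaPair n j) :=
  (commute_zetaPair_ι i _).mul_right (commute_zetaPair_ι i _)

theorem ι_zeta_mul_zetaPair (j : Fin n) :
    ExteriorAlgebra.ι ℂ (zeta n j) * zetaPair n j = 0 := by
  rw [zetaPair, ← mul_assoc, ExteriorAlgebra.ι_sq_zero, zero_mul]

theorem ι_zetaBar_mul_zetaPair (j : Fin n) :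
    ExteriorAlgebra.ι ℂ (zetaBar n j) * zetaPair n j = 0 := by
  rw [← (commute_zetaPair_ι j _).eq, zetaPair, mul_assoc, ExteriorAlgebra.ι_sq_zero, mul_zero]

theorem zetaPair_mul_self (j : Fin n) : zetaPair n j * zetaPair n j = 0 := by
  nth_rewrite 1 [zetaPair]
  rw [mul_assoc, ι_zetaBar_mul_zetaPair, mul_zero]

theorem eta_eq (n : ℕ) : eta n = Complex.I • ∑ j, zetaPair n j := rfl

/-- The functional `w ↦ (w(e_j) + c w(i e_j)) / 2` on complexified covectors. -/
def wirtinger (n : ℕ) (c : ℂ) (j : Fin n) : Module.Dual ℂ (Wc n) where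
  toFun w := (w (EuclideanSpace.single j 1) + c * w (EuclideanSpace.single j Complex.I)) / 2
  map_add' v w := by simp only [LinearMap.add_apply]; ring
  map_smul' t w := by simp only [LinearMap.smul_apply, smul_eq_mul, RingHom.id_apply]; ring

theorem wirtinger_zeta (c : ℂ) (j k : Fin n) :
    wirtinger n c j (zeta n k) = if k = j then (1 + c * Complex.I) / 2 else 0 := by
  simp only [wirtinger, zeta, LinearMap.coe_mk, AddHom.coe_mk, LinearMap.restrictScalars_apply,
    ContinuousLinearMap.coe_coe, PiLp.proj_apply, PiLp.single_apply]
  split_ifs <;> simp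

theorem wirtinger_zetaBar (c : ℂ) (j k : Fin n) :
    wirtinger n c j (zetaBar n k) = if k = j then (1 - c * Complex.I) / 2 else 0 := by
  simp only [wirtinger, zetaBar, zeta, LinearMap.coe_mk, AddHom.coe_mk, LinearMap.comp_apply,
    LinearMap.restrictScalars_apply, ContinuousLinearMap.coe_coe, PiLp.proj_apply,
    PiLp.single_apply]
  split_ifs <;> simp [sub_eq_add_neg]

theorem contractLeft_noncommProd_zetaPair {j : Fin n} (c : ℂ) (S : Finset (Fin n)) (hj : j ∉ S) :
    CliffordAlgebra.contractLeft (wirtinger n c j)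
      (S.noncommProd (zetaPair n) (pairwise_commute zetaPair_commute _)) = 0 := by
  induction S using Finset.induction_on with
  | empty => simp
  | insert k S hk ih =>
    have hjk : k ≠ j := fun h => hj (h ▸ Finset.mem_insert_self k S)
    rw [Finset.noncommProd_insert_of_notMem _ _ _ _ hk, zetaPair, mul_assoc, ExteriorAlgebra.ι,
      CliffordAlgebra.contractLeft_ι_mul, CliffordAlgebra.contractLeft_ι_mul,
      ih fun h => hj (Finset.mem_insert_of_mem h), wirtinger_zeta, wirtinger_zetaBar]
    simp [hjk]

theorem noncommProd_zetaPair_ne_zero (S : Finset (Fin n)) :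
    (S.noncommProd (zetaPair n) (pairwise_commute zetaPair_commute _)) ≠ 0 := by
  induction S using Finset.induction_on with
  | empty => simp
  | insert j S hj ih =>
    intro h
    apply ih
    rw [Finset.noncommProd_insert_of_notMem _ _ _ _ hj, zetaPair, mul_assoc,
      ExteriorAlgebra.ι] at h
    have h₀ := congrArg (CliffordAlgebra.contractLeft (wirtinger n Complex.I j))
      (congrArg (CliffordAlgebra.contractLeft (wirtinger n (-Complex.I) j)) h)
    simpa [CliffordAlgebra.contractLeft_ι_mul, contractLeft_noncommProd_zetaPair _ S hj,
      wirtinger_zeta, wirtinger_zetaBar] using h₀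

/-- Products of four coordinate covectors against `η ^ (n - 2)`, as multiples of one fixed
nonzero top-degree form. -/
theorem exists_coord_mul_eta_pow (hn : 1 < n) : ∃ P : ExtAlg n, P ≠ 0 ∧ ∀ i j k l : Fin n,
    ExteriorAlgebra.ι ℂ (zeta n i) * ExteriorAlgebra.ι ℂ (zetaBar n j) *
      (ExteriorAlgebra.ι ℂ (zeta n k) * ExteriorAlgebra.ι ℂ (zetaBar n l)) * eta n ^ (n - 2) =
    ((if i = j ∧ k = l then (1 : ℂ) else 0) - if i = l ∧ k = j then 1 else 0) • P := by
  have pair : ∀ i k : Fin n, i ≠ k → zetaPair n i * zetaPair n k * eta n ^ (n - 2) =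
      (Complex.I ^ (n - 2) * (n - 2).factorial) •
        Finset.univ.noncommProd (zetaPair n) (pairwise_commute zetaPair_commute _) := by
    intro i k hik
    have := noncommProd_mul_sum_pow (e := zetaPair n) zetaPair_commute zetaPair_mul_self (n - 2)
      {i, k} (by rw [Finset.card_pair hik, Fintype.card_fin]; omega)
    rw [Finset.noncommProd_insert_of_notMem _ _ _ _ (by simpa using hik),
      Finset.noncommProd_singleton] at this
    rw [eta_eq, smul_pow, mul_smul_comm, this, mul_smul, Nat.cast_smul_eq_nsmul]
  refine ⟨_, smul_ne_zero (mul_ne_zero (pow_ne_zero (n - 2) Complex.I_ne_zero)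
    (Nat.cast_ne_zero.2 (Nat.factorial_ne_zero (n - 2))))
    (noncommProd_zetaPair_ne_zero Finset.univ), fun i j k l => ?_⟩
  have swap : ExteriorAlgebra.ι ℂ (zeta n i) * ExteriorAlgebra.ι ℂ (zetaBar n j) *
      (ExteriorAlgebra.ι ℂ (zeta n k) * ExteriorAlgebra.ι ℂ (zetaBar n l)) =
      -(ExteriorAlgebra.ι ℂ (zeta n i) * ExteriorAlgebra.ι ℂ (zetaBar n l) *
      (ExteriorAlgebra.ι ℂ (zeta n k) * ExteriorAlgebra.ι ℂ (zetaBar n j))) := by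
    rw [mul_assoc, ← (commute_ι_mul_ι _ _ _).eq, mul_assoc (ExteriorAlgebra.ι ℂ (zeta n k)),
      ι_mul_ι_anticomm (zetaBar n l), mul_neg, mul_neg, ← mul_assoc (ExteriorAlgebra.ι ℂ (zeta n k)),
      (commute_ι_mul_ι _ _ _).eq, mul_assoc]
  by_cases hik : i = k
  · subst hik
    have : (i = j ∧ i = l) ↔ (i = l ∧ i = j) := and_comm
    rw [mul_assoc (ExteriorAlgebra.ι ℂ (zeta n i)), ← mul_assoc (ExteriorAlgebra.ι ℂ (zetaBar n j)),
      ι_mul_ι_anticomm (zetaBar n j), neg_mul, mul_neg, ← mul_assoc, ← mul_assoc,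
      ExteriorAlgebra.ι_sq_zero]
    simp [this]
  by_cases hjl : j = l
  · subst hjl
    have : ExteriorAlgebra.ι ℂ (zeta n i) * ExteriorAlgebra.ι ℂ (zetaBar n j) *
      (ExteriorAlgebra.ι ℂ (zeta n k) * ExteriorAlgebra.ι ℂ (zetaBar n j)) = 0 := by
      rw [ι_mul_ι_anticomm (zeta n k), mul_neg, mul_assoc,
        ← mul_assoc (ExteriorAlgebra.ι ℂ (zetaBar n j)), ExteriorAlgebra.ι_sq_zero, zero_mul,
        mul_zero, neg_zero]
    simp [this]
  by_cases h₁ : i = j ∧ k = l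
  · obtain ⟨rfl, rfl⟩ := h₁
    rw [if_pos ⟨rfl, rfl⟩, if_neg fun h => hik h.1, sub_zero, one_smul]
    exact pair i k hik
  by_cases h₂ : i = l ∧ k = j
  · obtain ⟨rfl, rfl⟩ := h₂
    rw [if_neg h₁, if_pos ⟨rfl, rfl⟩, zero_sub, neg_smul, one_smul, swap, neg_mul]
    exact congrArg _ (pair i k hik)
  rw [if_neg h₁, if_neg h₂, sub_zero, zero_smul, eta_eq, smul_pow, mul_smul_comm]
  have push : ∀ (m : Fin n) (x : ExtAlg n) (w : Wc n), x * zetaPair n m = 0 →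
      x * ExteriorAlgebra.ι ℂ w * zetaPair n m = 0 := by
    intro m x w hx
    rw [mul_assoc, ← (commute_zetaPair_ι m w).eq, ← mul_assoc, hx, zero_mul]
  rw [mul_sum_pow_eq_zero zetaPair_commute zetaPair_mul_self (n - 2) _ {i, j, k, l}, smul_zero]
  · intro m hm
    simp only [Finset.mem_insert, Finset.mem_singleton] at hm
    rw [← mul_assoc]
    rcases hm with rfl | rfl | rfl | rfl
    · exact push _ _ _ (push _ _ _ (push _ _ _ (ι_zeta_mul_zetaPair _)))
    · exact push _ _ _ (push _ _ _ (by rw [mul_assoc, ι_zetaBar_mul_zetaPair, mul_zero]))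
    · exact push _ _ _ (by rw [mul_assoc, ι_zeta_mul_zetaPair, mul_zero])
    · rw [mul_assoc, ι_zetaBar_mul_zetaPair, mul_zero]
  · have : 2 < ({i, j, k, l} : Finset (Fin n)).card := by
      rw [Finset.two_lt_card]
      by_cases hij : i = j
      · exact ⟨i, by simp, k, by simp, l, by simp, hik, by grind, by grind⟩
      · by_cases hkj : k = j
        · exact ⟨i, by simp, j, by simp, l, by simp, hij, by grind, hjl⟩
        · exact ⟨i, by simp, j, by simp, k, by simp, hij, hik, Ne.symm hkj⟩
    rw [Fintype.card_fin]
    omega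

end Covectors

theorem form10_mul_form01 (n : ℕ) (a b : Fin n → ℂ) :
    form10 n a * form01 n b = ∑ i, ∑ j, (a i * (starRingEnd ℂ) (b j)) •
      (ExteriorAlgebra.ι ℂ (zeta n i) * ExteriorAlgebra.ι ℂ (zetaBar n j)) := by
  simp only [form10, form01, Finset.sum_mul_sum, smul_mul_smul_comm]

theorem form10_mul_form10_eq_zero {n : ℕ} {a b : Fin n → ℂ} (h : ∀ i k, a i * b k = a k * b i) :
    form10 n a * form10 n b = 0 := by
  have key : form10 n a * form10 n b = ∑ i, ∑ k, (a i * b k) •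
      (ExteriorAlgebra.ι ℂ (zeta n i) * ExteriorAlgebra.ι ℂ (zeta n k)) := by
    simp only [form10, Finset.sum_mul_sum, smul_mul_smul_comm]
  have neg : form10 n a * form10 n b = -(form10 n a * form10 n b) := by
    rw [key, ← Finset.sum_neg_distrib]
    refine Finset.sum_comm.trans (Finset.sum_congr rfl fun i _ => ?_)
    rw [← Finset.sum_neg_distrib]
    refine Finset.sum_congr rfl fun k _ => ?_
    rw [ι_mul_ι_anticomm, smul_neg, h]
  have : IsAddTorsionFree (ExtAlg n) := .of_isTorsionFree ℂ _
  exact self_eq_neg.1 neg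

open scoped MatrixOrder Matrix.Norms.L2Operator in
theorem Matrix.PosSemidef.exists_eq_conjTranspose_mul_self {n : ℕ}
    {B : Matrix (Fin n) (Fin n) ℂ} (hB : B.PosSemidef) : ∃ C, B = C.conjTranspose * C :=
  CStarAlgebra.nonneg_iff_eq_star_mul_self.1 hB.nonneg

/-- The form of `Cᴴ * C` is a sum of decomposable forms over the rows of `C`. -/
theorem form11_conjTranspose_mul_self (n : ℕ) (C : Matrix (Fin n) (Fin n) ℂ) :
    form11 n (C.conjTranspose * C) = Complex.I • ∑ p,
      form10 n (fun i => (starRingEnd ℂ) (C p i)) * form01 n (fun i => (starRingEnd ℂ) (C p i)) := by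
  simp only [form11, form10_mul_form01, Complex.conj_conj, Matrix.mul_apply,
    Matrix.conjTranspose_apply, Finset.sum_smul]
  congr 1
  rw [Finset.sum_comm_cycle]
  rfl

theorem form10_form01_mul_eta_pow {n : ℕ} {P : ExtAlg n} (hP : ∀ i j k l : Fin n,
    ExteriorAlgebra.ι ℂ (zeta n i) * ExteriorAlgebra.ι ℂ (zetaBar n j) *
      (ExteriorAlgebra.ι ℂ (zeta n k) * ExteriorAlgebra.ι ℂ (zetaBar n l)) * eta n ^ (n - 2) =
    ((if i = j ∧ k = l then (1 : ℂ) else 0) - if i = l ∧ k = j then 1 else 0) • P)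
    (a b : Fin n → ℂ) :
    (form10 n a * form01 n a) * (form10 n b * form01 n b) * eta n ^ (n - 2) =
      (((∑ i, ∑ k, Complex.normSq (a i * b k - a k * b i)) / 2 : ℝ) : ℂ) • P := by
  have key : (form10 n a * form01 n a) * (form10 n b * form01 n b) * eta n ^ (n - 2) =
      (∑ i, ∑ k, (a i * (starRingEnd ℂ) (a i) * (b k * (starRingEnd ℂ) (b k)) -
        a i * (starRingEnd ℂ) (a k) * (b k * (starRingEnd ℂ) (b i)))) • P := by
    have inner : ∀ i k : Fin n, ∑ j, ∑ l, (a i * (starRingEnd ℂ) (a j) *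
        (b k * (starRingEnd ℂ) (b l))) •
        (((if i = j ∧ k = l then (1 : ℂ) else 0) - if i = l ∧ k = j then 1 else 0) • P) =
        (a i * (starRingEnd ℂ) (a i) * (b k * (starRingEnd ℂ) (b k)) -
        a i * (starRingEnd ℂ) (a k) * (b k * (starRingEnd ℂ) (b i))) • P := by
      intro i k
      simp only [← mul_smul, ← Finset.sum_smul]
      congr 1
      simp [mul_sub, Finset.sum_sub_distrib, ite_and]
    simp only [form10_mul_form01, Finset.sum_mul, Finset.mul_sum, smul_mul_assoc, mul_smul_comm,
      smul_smul, Finset.smul_sum, hP, Finset.sum_smul, ← inner]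
    refine Eq.trans (Finset.sum_congr rfl fun k _ => ?_) Finset.sum_comm
    refine Eq.trans ?_ Finset.sum_comm_cycle.symm
    refine Finset.sum_congr rfl fun l _ => Finset.sum_congr rfl fun i _ =>
      Finset.sum_congr rfl fun j _ => ?_
    congr 1
    ring
  rw [key]
  congr 1
  have swap : ∀ f : Fin n → Fin n → ℂ, ∑ i, ∑ k, f i k = (∑ i, ∑ k, (f i k + f k i)) / 2 := by
    intro f
    simp only [Finset.sum_add_distrib]
    rw [Finset.sum_comm (f := fun i k => f k i)]
    ring
  rw [swap]
  push_cast
  congr 1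
  refine Finset.sum_congr rfl fun i _ => Finset.sum_congr rfl fun k _ => ?_
  rw [← Complex.mul_conj]
  simp only [map_sub, map_mul]
  ring

/-- Lemma 5.1(d): if `ω_1` is a `(1,0)`-form, `α = i ω_1 ∧ ω̄_1`, `β ≥ 0` is a real
skew-symmetric `(1,1)`-form, and `α ∧ β ∧ η^(n-2) = 0`, then `ω_1 ∧ β = 0`. -/
theorem statement4 (n : ℕ) (hn : 1 < n) (a : Fin n → ℂ) (B : Matrix (Fin n) (Fin n) ℂ)
    (hB : B.PosSemidef)
    (h : (Complex.I • (form10 n a * form01 n a)) * form11 n B * eta n ^ (n - 2) = 0) :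
    form10 n a * form11 n B = 0 := by
  obtain ⟨P, hP₀, hP⟩ := exists_coord_mul_eta_pow hn
  obtain ⟨C, rfl⟩ := hB.exists_eq_conjTranspose_mul_self
  rw [form11_conjTranspose_mul_self, smul_mul_smul_comm, smul_mul_assoc,
    smul_eq_zero_iff_right (mul_ne_zero Complex.I_ne_zero Complex.I_ne_zero), Finset.mul_sum,
    Finset.sum_mul] at h
  simp only [form10_form01_mul_eta_pow hP] at h
  rw [← Finset.sum_smul, smul_eq_zero_iff_left hP₀, ← Complex.ofReal_sum,
    Complex.ofReal_eq_zero, Finset.sum_eq_zero_iff_of_nonneg fun p _ => div_nonneg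
      (Finset.sum_nonneg fun i _ => Finset.sum_nonneg fun k _ => Complex.normSq_nonneg _)
      zero_le_two] at h
  rw [form11_conjTranspose_mul_self, mul_smul_comm, Finset.mul_sum, Finset.sum_eq_zero, smul_zero]
  intro p hp
  rw [← mul_assoc, form10_mul_form10_eq_zero, zero_mul]
  intro i k
  have h₁ := (div_eq_zero_iff.1 (h p hp)).resolve_right two_ne_zero
  rw [Finset.sum_eq_zero_iff_of_nonneg fun i _ => Finset.sum_nonneg fun k _ =>
    Complex.normSq_nonneg _] at h₁
  have h₂ := h₁ i (Finset.mem_univ i)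
  rw [Finset.sum_eq_zero_iff_of_nonneg fun k _ => Complex.normSq_nonneg _] at h₂
  exact sub_eq_zero.1 (Complex.normSq_eq_zero.1 (h₂ k (Finset.mem_univ k)))
end
end
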